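/- There exist universal constants c₁ > 0 and c₂ > 0 such that the following holds. For every near-separable instance M̃ = WH + N as in the assumption with m = r (so W ∈ ℝ^{r×r} is invertible), and for every matrix Q ∈ ℝ^{r×r} such that QW is invertible, if ε ≤ c₁ · σ_min(QW) / (√r · σ_max(Q) · κ(QW)²), then the index set K produced by SPA applied to the preconditioned matrix QM̃ with parameter r satisfies max_{1≤j≤r} min_{k∈K} ‖W(:,j) − M̃(:,k)‖₂ ≤ c₂ · ε · κ(Q) · κ(QW)². -/

import Mathlib

open Matrix BigOperators

/-- Euclidean norm of a vector in `ℝ^m`. -/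
noncomputable def colNorm {m : ℕ} (v : Fin m → ℝ) : ℝ := Real.sqrt (∑ i, (v i) ^ 2)

/-- Largest singular value of a matrix. -/
noncomputable def sigmaMax {m n : ℕ} (X : Matrix (Fin m) (Fin n) ℝ) : ℝ :=
  sSup {c : ℝ | ∃ v : Fin n → ℝ, colNorm v = 1 ∧ c = colNorm (X.mulVec v)}

/-- Smallest singular value of a matrix. -/
noncomputable def sigmaMin {m n : ℕ} (X : Matrix (Fin m) (Fin n) ℝ) : ℝ :=
  sInf {c : ℝ | ∃ v : Fin n → ℝ, colNorm v = 1 ∧ c = colNorm (X.mulVec v)}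

/-- Condition number `κ(X) = σ_max(X) / σ_min(X)`. -/
noncomputable def kappa {m n : ℕ} (X : Matrix (Fin m) (Fin n) ℝ) : ℝ :=
  sigmaMax X / sigmaMin X

/-- Projection of the columns of `X` onto the orthogonal complement of `u`:
`X ← (I − uuᵀ/‖u‖²) X`. -/
noncomputable def projOut {m n : ℕ} (u : Fin m → ℝ) (X : Matrix (Fin m) (Fin n) ℝ) :
    Matrix (Fin m) (Fin n) ℝ :=
  fun i j => X i j - ((∑ l, u l * X l j) / (∑ l, u l * u l)) * u i

/-- `IsSPA X r K` holds iff `K` is a possible output of the successive projection algorithm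
applied to `X` with `r` steps (for some tie-breaking choices in the argmax steps). -/
inductive IsSPA {m n : ℕ} : Matrix (Fin m) (Fin n) ℝ → ℕ → Finset (Fin n) → Prop
  | nil (X : Matrix (Fin m) (Fin n) ℝ) : IsSPA X 0 ∅
  | step (X : Matrix (Fin m) (Fin n) ℝ) (r : ℕ) (k : Fin n) (K : Finset (Fin n)) :
      (∀ j : Fin n, colNorm (fun i => X i j) ≤ colNorm (fun i => X i k)) →
      IsSPA (projOut (fun i => X i k) X) r K →
      IsSPA X (r + 1) (insert k K)

/-- Near-separable assumption: `Mt = W * H + N` where `W` has full column rank,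
`H` is nonnegative with column sums at most one and contains each standard basis vector
among its columns, and each column of `N` has Euclidean norm at most `ε`. -/
def NearSeparable (m n r : ℕ) (W : Matrix (Fin m) (Fin r) ℝ) (H : Matrix (Fin r) (Fin n) ℝ)
    (N Mt : Matrix (Fin m) (Fin n) ℝ) (ε : ℝ) : Prop :=
  Mt = W * H + N ∧ W.rank = r ∧ (∀ i j, 0 ≤ H i j) ∧ (∀ j, ∑ i, H i j ≤ 1) ∧
    (∀ j : Fin r, ∃ c : Fin n, ∀ i, H i c = if i = j then 1 else 0) ∧
    0 ≤ ε ∧ ∀ j, colNorm (fun i => N i j) ≤ ε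

open scoped InnerProductSpace

section Convexity

variable {ι E : Type*} [Fintype ι] [NormedAddCommGroup E] [InnerProductSpace ℝ E]

/-- The variance identity for weighted families of vectors. -/
lemma sum_sum_mul_norm_sub_sq (h : ι → ℝ) (p : ι → E) :
    ∑ i, ∑ j, h i * (h j * ‖p i - p j‖ ^ 2) =
      2 * ((∑ i, h i) * ∑ i, h i * ‖p i‖ ^ 2) - 2 * ‖∑ i, h i • p i‖ ^ 2 := by
  have h1 : ‖∑ i, h i • p i‖ ^ 2 = ∑ i, ∑ j, h i * (h j * ⟪p i, p j⟫_ℝ) := by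
    rw [← real_inner_self_eq_norm_sq, sum_inner]
    refine Finset.sum_congr rfl fun i _ => ?_
    rw [inner_sum]
    refine Finset.sum_congr rfl fun j _ => ?_
    rw [real_inner_smul_left, real_inner_smul_right]
  have h2 : (∑ i, h i) * ∑ i, h i * ‖p i‖ ^ 2 = ∑ i, ∑ j, h i * (h j * ‖p j‖ ^ 2) :=
    Finset.sum_mul_sum _ _ _ _
  have h3 : (∑ i, h i) * ∑ i, h i * ‖p i‖ ^ 2 = ∑ i, ∑ j, h i * (h j * ‖p i‖ ^ 2) := by
    rw [h2, Finset.sum_comm]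
    exact Finset.sum_congr rfl fun i _ => Finset.sum_congr rfl fun j _ => by ring
  have h4 : 2 * ((∑ i, h i) * ∑ i, h i * ‖p i‖ ^ 2) =
      ∑ i, ∑ j, h i * (h j * ‖p i‖ ^ 2) + ∑ i, ∑ j, h i * (h j * ‖p j‖ ^ 2) := by
    rw [← h2, ← h3]; ring
  rw [h4, h1, Finset.mul_sum, ← Finset.sum_add_distrib, ← Finset.sum_sub_distrib]
  refine Finset.sum_congr rfl fun i _ => ?_
  rw [Finset.mul_sum, ← Finset.sum_add_distrib, ← Finset.sum_sub_distrib]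
  refine Finset.sum_congr rfl fun j _ => ?_
  rw [norm_sub_sq_real]; ring

variable [DecidableEq ι]

/-- A subconvex combination of almost maximal norm concentrates on one of the well separated
vectors of the family. -/
lemma exists_weight_near_one {S : Finset ι} {h : ι → ℝ} {p : ι → E} {V ε σ τ : ℝ}
    (hnn : ∀ i, 0 ≤ h i) (hsum : ∑ i, h i ≤ 1) (hσ : 0 < σ) (hε : 0 ≤ ε) (hεσ : 32 * ε ≤ σ)
    (hV : σ / 2 ≤ V) (hVτ : V ≤ τ) (hστ : σ ≤ τ)
    (hR : ∀ j ∉ S, ‖p j‖ ≤ V) (hS : ∀ j ∈ S, ‖p j‖ ≤ V / 2)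
    (hsep : ∀ i ∉ S, ∀ j ∉ S, i ≠ j → σ / 2 ≤ ‖p i - p j‖)
    (hlarge : V - 2 * ε ≤ ‖∑ i, h i • p i‖) :
    ∃ j ∉ S, (1 - h j) * σ ^ 2 ≤ 75 * ε * τ := by
  have hV0 : 0 < V := by linarith
  set η := ∑ i ∈ Sᶜ, h i with hη
  have hsplit : ∑ i ∈ S, h i + η = ∑ i, h i := Finset.sum_add_sum_compl S h
  have hη0 : 0 ≤ η := Finset.sum_nonneg fun i _ => hnn i
  have hs0 : 0 ≤ ∑ i, h i := Finset.sum_nonneg fun i _ => hnn i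
  have hB : ∑ i, h i * ‖p i‖ ^ 2 ≤ (∑ i ∈ S, h i) * (V / 2) ^ 2 + η * V ^ 2 := by
    rw [← Finset.sum_add_sum_compl S, hη, Finset.sum_mul, Finset.sum_mul]
    refine add_le_add (Finset.sum_le_sum fun i hi => ?_) (Finset.sum_le_sum fun i hi => ?_)
    · exact mul_le_mul_of_nonneg_left (pow_le_pow_left₀ (norm_nonneg _) (hS i hi) 2) (hnn i)
    · exact mul_le_mul_of_nonneg_left
        (pow_le_pow_left₀ (norm_nonneg _) (hR i (Finset.mem_compl.1 hi)) 2) (hnn i)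
  have hB0 : 0 ≤ ∑ i, h i * ‖p i‖ ^ 2 :=
    Finset.sum_nonneg fun i _ => mul_nonneg (hnn i) (sq_nonneg _)
  have hvar := sum_sum_mul_norm_sub_sq h p
  have hterm : ∀ i j, 0 ≤ h i * (h j * ‖p i - p j‖ ^ 2) := fun i j =>
    mul_nonneg (hnn i) (mul_nonneg (hnn j) (sq_nonneg _))
  have hL : V ^ 2 - 4 * ε * V ≤ ‖∑ i, h i • p i‖ ^ 2 := by
    have := pow_le_pow_left₀ (by linarith : 0 ≤ V - 2 * ε) hlarge 2
    nlinarith [sq_nonneg ε]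
  have hsB : (∑ i, h i) * ∑ i, h i * ‖p i‖ ^ 2 ≤ ∑ i, h i * ‖p i‖ ^ 2 :=
    mul_le_of_le_one_left hB0 hsum
  have hB' : ∑ i, h i * ‖p i‖ ^ 2 ≤ V ^ 2 - 3 / 4 * (1 - η) * V ^ 2 := by
    have : ∑ i ∈ S, h i ≤ 1 - η := by linarith
    nlinarith [mul_le_mul_of_nonneg_right this (sq_nonneg V)]
  have hvar0 : 0 ≤ ∑ i, ∑ j, h i * (h j * ‖p i - p j‖ ^ 2) :=
    Finset.sum_nonneg fun i _ => Finset.sum_nonneg fun j _ => hterm i j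
  have hη1 : η ≤ 1 := by
    have : 0 ≤ ∑ i ∈ S, h i := Finset.sum_nonneg fun i _ => hnn i
    linarith
  have hgap : (1 - η) * V ≤ 16 / 3 * ε := by
    have : ((1 - η) * V) * V ≤ (16 / 3 * ε) * V := by nlinarith
    exact le_of_mul_le_mul_right this hV0
  have hgap' : (1 - η) * σ ≤ 32 / 3 * ε := by nlinarith
  have hhalf : 1 / 2 ≤ η := by
    by_contra hcon
    push Not at hcon
    nlinarith
  have hne : (Sᶜ : Finset ι).Nonempty := by
    by_contra hcon
    rw [Finset.not_nonempty_iff_eq_empty] at hcon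
    rw [hη, hcon, Finset.sum_empty] at hhalf
    norm_num at hhalf
  obtain ⟨m, hm, hmax⟩ := Finset.exists_max_image Sᶜ h hne
  refine ⟨m, Finset.mem_compl.1 hm, ?_⟩
  have hrow : ∀ i ∈ Sᶜ, (η - h m) * (σ / 2) ^ 2 ≤ ∑ j, h j * ‖p i - p j‖ ^ 2 := by
    intro i hi
    calc (η - h m) * (σ / 2) ^ 2 ≤ (η - h i) * (σ / 2) ^ 2 :=
          mul_le_mul_of_nonneg_right (by linarith [hmax i hi]) (sq_nonneg _)
      _ = ∑ j ∈ Sᶜ.erase i, h j * (σ / 2) ^ 2 := by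
          rw [← Finset.sum_mul, hη, ← Finset.add_sum_erase _ h hi]; ring
      _ ≤ ∑ j ∈ Sᶜ.erase i, h j * ‖p i - p j‖ ^ 2 := by
          refine Finset.sum_le_sum fun j hj => mul_le_mul_of_nonneg_left ?_ (hnn j)
          rw [Finset.mem_erase] at hj
          exact pow_le_pow_left₀ (by linarith) (hsep i (Finset.mem_compl.1 hi) j
            (Finset.mem_compl.1 hj.2) hj.1.symm) 2
      _ ≤ ∑ j, h j * ‖p i - p j‖ ^ 2 :=
          Finset.sum_le_sum_of_subset_of_nonneg (Finset.subset_univ _)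
            fun j _ _ => mul_nonneg (hnn j) (sq_nonneg _)
  have hlow : η * ((η - h m) * (σ / 2) ^ 2) ≤ ∑ i, ∑ j, h i * (h j * ‖p i - p j‖ ^ 2) := by
    calc η * ((η - h m) * (σ / 2) ^ 2)
        ≤ ∑ i ∈ Sᶜ, ∑ j, h i * (h j * ‖p i - p j‖ ^ 2) := by
          rw [hη, Finset.sum_mul]
          refine Finset.sum_le_sum fun i hi => ?_
          rw [← Finset.mul_sum]
          exact mul_le_mul_of_nonneg_left (hrow i hi) (hnn i)
      _ ≤ _ := Finset.sum_le_sum_of_subset_of_nonneg (Finset.subset_univ _)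
            fun i _ _ => Finset.sum_nonneg fun j _ => hterm i j
  have hm_le : h m ≤ η := Finset.single_le_sum (f := h) (fun i _ => hnn i) hm
  have hup : η * ((η - h m) * (σ / 2) ^ 2) ≤ 8 * ε * V := by
    have : 0 ≤ (1 - η) * V ^ 2 := mul_nonneg (by linarith) (sq_nonneg V)
    linarith
  have hx0 : 0 ≤ (η - h m) * (σ / 2) ^ 2 := mul_nonneg (by linarith) (sq_nonneg _)
  have hx : (η - h m) * (σ / 2) ^ 2 ≤ 16 * ε * V := by
    have := mul_le_mul_of_nonneg_right hhalf hx0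
    linarith
  have h5 : ε * V ≤ ε * τ := mul_le_mul_of_nonneg_left hVτ hε
  have h6 : ε * σ ≤ ε * τ := mul_le_mul_of_nonneg_left hστ hε
  have h7 : (1 - η) * σ ^ 2 ≤ 32 / 3 * ε * σ := by
    have := mul_le_mul_of_nonneg_right hgap' hσ.le
    linarith [this]
  have h8 : 0 ≤ ε * τ := mul_nonneg hε (by linarith)
  linarith [hx, h7, h5, h6, h8]

end Convexity

section Step

variable {ι κ E : Type*} [Fintype ι] [DecidableEq ι] [NormedAddCommGroup E]
  [InnerProductSpace ℝ E]

/-- A map which differs from the identity by elements of the span of approximations of the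
vectors `w j`, `j ∈ S`, stays bounded below on combinations of the other vectors. -/
lemma half_mul_abs_le_norm_residual {S : Finset ι} {w z : ι → E} {σ δ : ℝ} {P : E → E}
    (hσ : 0 ≤ σ) (hδ : 0 ≤ δ)
    (hw : ∀ c : ι → ℝ, σ * √(∑ j, c j ^ 2) ≤ ‖∑ j, c j • w j‖)
    (hδσ : δ * √(Fintype.card ι) ≤ σ / 2)
    (hz : ∀ j ∈ S, ‖w j - z j‖ ≤ δ)
    (hP : ∀ v, v - P v ∈ Submodule.span ℝ (z '' S))
    {a : ι → ℝ} (ha : ∀ j ∈ S, a j = 0) (i : ι) (hi : i ∉ S) :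
    σ / 2 * |a i| ≤ ‖P (∑ j, a j • w j)‖ := by
  obtain ⟨b, hb⟩ := (Submodule.mem_span_image_finset_iff_exists_fun' ℝ).1 (hP (∑ j, a j • w j))
  set b' : ι → ℝ := fun j => if j ∈ S then b j else 0 with hb'
  have hPeq : P (∑ j, a j • w j) =
      ∑ j, (a j - b' j) • w j + ∑ j ∈ S, b j • (w j - z j) := by
    have h1 : ∑ j, b' j • w j = ∑ j ∈ S, b j • w j := by
      simp [hb', ite_smul, Finset.sum_ite_mem]
    simp only [sub_smul, smul_sub, Finset.sum_sub_distrib]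
    rw [h1, hb]; abel
  set T := √(∑ j, (a j - b' j) ^ 2) with hT
  have hsmall : ‖∑ j ∈ S, b j • (w j - z j)‖ ≤ σ / 2 * T := by
    have h1 : ∑ j ∈ S, |b j| ≤ √(Fintype.card ι) * T := by
      calc ∑ j ∈ S, |b j| = ∑ j ∈ S, |a j - b' j| :=
            Finset.sum_congr rfl fun j hj => by simp [hb', hj, ha j hj]
        _ ≤ ∑ j, |a j - b' j| :=
            Finset.sum_le_sum_of_subset_of_nonneg (Finset.subset_univ _) fun j _ _ => abs_nonneg _
        _ ≤ √(Fintype.card ι) * T := by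
            rw [hT, ← Real.sqrt_mul (Nat.cast_nonneg _)]
            refine Real.le_sqrt_of_sq_le ?_
            simpa using sq_sum_le_card_mul_sum_sq (s := (Finset.univ : Finset ι))
              (f := fun j => |a j - b' j|)
    calc ‖∑ j ∈ S, b j • (w j - z j)‖ ≤ ∑ j ∈ S, |b j| * δ :=
          norm_sum_le_of_le _ fun j hj => by
            rw [norm_smul, Real.norm_eq_abs]
            exact mul_le_mul_of_nonneg_left (hz j hj) (abs_nonneg _)
      _ = δ * ∑ j ∈ S, |b j| := by rw [← Finset.sum_mul, mul_comm]
      _ ≤ δ * (√(Fintype.card ι) * T) := mul_le_mul_of_nonneg_left h1 hδ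
      _ ≤ σ / 2 * T := by
          rw [← mul_assoc]
          exact mul_le_mul_of_nonneg_right hδσ (Real.sqrt_nonneg _)
  have hbig := hw fun j => a j - b' j
  have hcoord : |a i| ≤ T := by
    refine Real.abs_le_sqrt ?_
    have : a i ^ 2 = (a i - b' i) ^ 2 := by simp [hb', hi]
    rw [this]
    exact Finset.single_le_sum (f := fun j => (a j - b' j) ^ 2) (fun j _ => sq_nonneg _)
      (Finset.mem_univ i)
  have htri : ‖∑ j, (a j - b' j) • w j‖ - ‖∑ j ∈ S, b j • (w j - z j)‖
      ≤ ‖P (∑ j, a j • w j)‖ := by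
    rw [hPeq]; exact norm_sub_le_norm_add _ _
  have := mul_le_mul_of_nonneg_left hcoord (by linarith : 0 ≤ σ / 2)
  linarith

/-- One greedy step on the residuals `P (x k)` picks a column close to a vector `w j` which has
not been approximated before. -/
lemma exists_near_of_norm_residual_max {S : Finset ι} {w z : ι → E} {σ τ ε δ : ℝ}
    {P : E →ₗ[ℝ] E} {h : κ → ι → ℝ} {x : κ → E}
    (hσ : 0 < σ) (hε : 0 ≤ ε) (hδ0 : 0 ≤ δ) (hεσ : 32 * ε ≤ σ) (hστ : σ ≤ τ)
    (hw : ∀ c : ι → ℝ, σ * √(∑ j, c j ^ 2) ≤ ‖∑ j, c j • w j‖)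
    (hwτ : ∀ j, ‖w j‖ ≤ τ)
    (hδ : 160 * ε * τ ^ 2 ≤ δ * σ ^ 2)
    (hδσ : δ * √(Fintype.card ι) ≤ σ / 2) (hδσ' : δ ≤ σ / 4)
    (hnn : ∀ k j, 0 ≤ h k j) (hsum : ∀ k, ∑ j, h k j ≤ 1)
    (hx : ∀ k, ‖x k - ∑ j, h k j • w j‖ ≤ ε)
    (hpure : ∀ j, ∃ k, ‖x k - w j‖ ≤ ε)
    (hz : ∀ j ∈ S, ‖w j - z j‖ ≤ δ) (hPz : ∀ j ∈ S, P (z j) = 0)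
    (hP1 : ∀ v, ‖P v‖ ≤ ‖v‖)
    (hP : ∀ v, v - P v ∈ Submodule.span ℝ (z '' S))
    (hS : Sᶜ.Nonempty) {k : κ} (hk : ∀ l, ‖P (x l)‖ ≤ ‖P (x k)‖) :
    ∃ j ∉ S, ‖w j - x k‖ ≤ δ := by
  obtain ⟨m, hm, hmax⟩ := Finset.exists_max_image Sᶜ (fun j => ‖P (w j)‖) hS
  rw [Finset.mem_compl] at hm
  have hlow : ∀ i ∉ S, ∀ a : ι → ℝ, (∀ j ∈ S, a j = 0) →
      σ / 2 * |a i| ≤ ‖P (∑ j, a j • w j)‖ := fun i hi a ha =>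
    half_mul_abs_le_norm_residual hσ.le hδ0 hw hδσ hz hP ha i hi
  have hV : σ / 2 ≤ ‖P (w m)‖ := by
    have := hlow m hm (Pi.single m 1) fun j hj => by
      rw [Pi.single_eq_of_ne]; rintro rfl; exact hm hj
    simpa [Pi.single_apply, ite_smul] using this
  have hsep : ∀ i ∉ S, ∀ j ∉ S, i ≠ j → σ / 2 ≤ ‖P (w i) - P (w j)‖ := by
    intro i hi j hj hij
    have := hlow i hi (Pi.single i 1 - Pi.single j 1) fun l hl => by
      have h1 : l ≠ i := by rintro rfl; exact hi hl
      have h2 : l ≠ j := by rintro rfl; exact hj hl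
      simp [h1, h2]
    simpa [Pi.single_apply, ite_smul, sub_smul, hij] using this
  have hPS : ∀ j ∈ S, ‖P (w j)‖ ≤ ‖P (w m)‖ / 2 := by
    intro j hj
    have h1 : P (w j) = P (w j - z j) := by rw [map_sub, hPz j hj, sub_zero]
    have h2 := (hP1 (w j - z j)).trans (hz j hj)
    rw [h1]; linarith
  have hlarge : ‖P (w m)‖ - 2 * ε ≤ ‖∑ j, h k j • P (w j)‖ := by
    obtain ⟨l, hl⟩ := hpure m
    have h1 : ‖P (x l) - P (w m)‖ ≤ ε := by rw [← map_sub]; exact (hP1 _).trans hl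
    have h2 : ‖P (x k) - ∑ j, h k j • P (w j)‖ ≤ ε := by
      have : P (x k) - ∑ j, h k j • P (w j) = P (x k - ∑ j, h k j • w j) := by
        simp [map_sub, map_sum]
      rw [this]; exact (hP1 _).trans (hx k)
    have h3 := norm_sub_norm_le (P (w m)) (P (x l))
    rw [norm_sub_rev] at h3
    have h4 := norm_sub_norm_le (P (x k)) (∑ j, h k j • P (w j))
    linarith [hk l]
  obtain ⟨j, hj, hh⟩ := exists_weight_near_one (hnn k) (hsum k) hσ hε hεσ hV
    ((hP1 _).trans (hwτ m)) hστ (fun j hj => hmax j (Finset.mem_compl.2 hj)) hPS hsep hlarge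
  refine ⟨j, hj, ?_⟩
  have hrest : ‖∑ i ∈ Finset.univ.erase j, h k i • w i‖ ≤ (1 - h k j) * τ := by
    calc _ ≤ ∑ i ∈ Finset.univ.erase j, h k i * τ := norm_sum_le_of_le _ fun i _ => by
            rw [norm_smul, Real.norm_eq_abs, abs_of_nonneg (hnn k i)]
            exact mul_le_mul_of_nonneg_left (hwτ i) (hnn k i)
      _ ≤ (1 - h k j) * τ := by
          rw [← Finset.sum_mul]
          refine mul_le_mul_of_nonneg_right ?_ (by linarith)
          linarith [hsum k, Finset.add_sum_erase Finset.univ (h k) (Finset.mem_univ j)]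
  have h1j : 0 ≤ 1 - h k j := by
    linarith [hsum k, Finset.single_le_sum (f := h k) (fun i _ => hnn k i) (Finset.mem_univ j)]
  have hdecomp : w j - x k = (1 - h k j) • w j - ∑ i ∈ Finset.univ.erase j, h k i • w i
      - (x k - ∑ i, h k i • w i) := by
    rw [← Finset.add_sum_erase Finset.univ (fun i => h k i • w i) (Finset.mem_univ j), sub_smul,
      one_smul]
    abel
  have hnorm : ‖w j - x k‖ ≤ 2 * ((1 - h k j) * τ) + ε := by
    rw [hdecomp]
    have e1 := norm_sub_le ((1 - h k j) • w j - ∑ i ∈ Finset.univ.erase j, h k i • w i)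
      (x k - ∑ i, h k i • w i)
    have e2 := norm_sub_le ((1 - h k j) • w j) (∑ i ∈ Finset.univ.erase j, h k i • w i)
    have e3 : ‖(1 - h k j) • w j‖ ≤ (1 - h k j) * τ := by
      rw [norm_smul, Real.norm_eq_abs, abs_of_nonneg h1j]
      exact mul_le_mul_of_nonneg_left (hwτ j) h1j
    linarith [hx k]
  have hσ2 : 0 < σ ^ 2 := by positivity
  refine hnorm.trans (le_of_mul_le_mul_right ?_ hσ2)
  have e1 := mul_le_mul_of_nonneg_right hh (by linarith : 0 ≤ τ)
  have e2 : ε * σ ^ 2 ≤ ε * τ ^ 2 :=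
    mul_le_mul_of_nonneg_left (pow_le_pow_left₀ hσ.le hστ 2) hε
  have e3 : 0 ≤ ε * τ ^ 2 := by positivity
  linarith

end Step

section Matrices

lemma colNorm_eq_norm {m : ℕ} (v : Fin m → ℝ) : colNorm v = ‖WithLp.toLp 2 v‖ := by
  simp [colNorm, EuclideanSpace.norm_eq]

lemma colNorm_nonneg {m : ℕ} (v : Fin m → ℝ) : 0 ≤ colNorm v := Real.sqrt_nonneg _

lemma colNorm_smul {m : ℕ} (c : ℝ) (v : Fin m → ℝ) : colNorm (c • v) = |c| * colNorm v := by
  rw [colNorm_eq_norm, WithLp.toLp_smul, norm_smul, colNorm_eq_norm, Real.norm_eq_abs]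

lemma colNorm_single {m : ℕ} (j : Fin m) : colNorm (Pi.single j (1 : ℝ)) = 1 := by
  simp [colNorm, Pi.single_apply]

lemma exists_colNorm_mulVec_le {m n : ℕ} (X : Matrix (Fin m) (Fin n) ℝ) :
    ∃ C, 0 ≤ C ∧ ∀ v, colNorm (X.mulVec v) ≤ C * colNorm v := by
  refine ⟨‖(Matrix.toEuclideanLin X).toContinuousLinearMap‖, norm_nonneg _, fun v => ?_⟩
  rw [colNorm_eq_norm, colNorm_eq_norm]
  exact (Matrix.toEuclideanLin X).toContinuousLinearMap.le_opNorm (WithLp.toLp 2 v)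

lemma colNorm_mulVec_le_sigmaMax_mul {m n : ℕ} (X : Matrix (Fin m) (Fin n) ℝ) (v : Fin n → ℝ) :
    colNorm (X.mulVec v) ≤ sigmaMax X * colNorm v := by
  obtain ⟨C, -, hC⟩ := exists_colNorm_mulVec_le X
  rcases (colNorm_nonneg v).eq_or_lt with h | h
  · have := hC v
    rw [← h, mul_zero] at this ⊢
    exact this
  · have hunit : colNorm ((colNorm v)⁻¹ • v) = 1 := by
      rw [colNorm_smul, abs_of_pos (inv_pos.2 h), inv_mul_cancel₀ h.ne']
    have hle : colNorm (X.mulVec ((colNorm v)⁻¹ • v)) ≤ sigmaMax X := by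
      refine le_csSup ⟨C, ?_⟩ ⟨_, hunit, rfl⟩
      rintro _ ⟨u, hu, rfl⟩
      simpa [hu] using hC u
    rw [Matrix.mulVec_smul, colNorm_smul, abs_of_pos (inv_pos.2 h)] at hle
    rwa [inv_mul_le_iff₀ h, mul_comm] at hle

lemma sigmaMin_mul_le_colNorm_mulVec {m n : ℕ} (X : Matrix (Fin m) (Fin n) ℝ)
    (v : Fin n → ℝ) : sigmaMin X * colNorm v ≤ colNorm (X.mulVec v) := by
  rcases (colNorm_nonneg v).eq_or_lt with h | h
  · rw [← h, mul_zero]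
    exact colNorm_nonneg _
  · have hunit : colNorm ((colNorm v)⁻¹ • v) = 1 := by
      rw [colNorm_smul, abs_of_pos (inv_pos.2 h), inv_mul_cancel₀ h.ne']
    have hle : sigmaMin X ≤ colNorm (X.mulVec ((colNorm v)⁻¹ • v)) := by
      refine csInf_le ⟨0, ?_⟩ ⟨_, hunit, rfl⟩
      rintro _ ⟨u, -, rfl⟩
      exact colNorm_nonneg _
    rw [Matrix.mulVec_smul, colNorm_smul, abs_of_pos (inv_pos.2 h)] at hle
    rwa [le_inv_mul_iff₀ h, mul_comm] at hle

lemma sigmaMin_pos {r : ℕ} (hr : 0 < r) {X : Matrix (Fin r) (Fin r) ℝ} (hX : IsUnit X.det) :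
    0 < sigmaMin X := by
  obtain ⟨C, hC0, hC⟩ := exists_colNorm_mulVec_le X⁻¹
  refine lt_of_lt_of_le (inv_pos.2 (by linarith : 0 < C + 1)) ?_
  refine le_csInf ⟨_, _, colNorm_single ⟨0, hr⟩, rfl⟩ ?_
  rintro _ ⟨v, hv, rfl⟩
  have h := hC (X.mulVec v)
  rw [Matrix.mulVec_mulVec, Matrix.nonsing_inv_mul _ hX, Matrix.one_mulVec, hv] at h
  rw [inv_le_iff_one_le_mul₀' (by linarith)]
  linarith [colNorm_nonneg (X.mulVec v)]

lemma sigmaMin_le_sigmaMax {m n : ℕ} (hn : 0 < n) (X : Matrix (Fin m) (Fin n) ℝ) :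
    sigmaMin X ≤ sigmaMax X := by
  have h1 := sigmaMin_mul_le_colNorm_mulVec X (Pi.single ⟨0, hn⟩ 1)
  have h2 := colNorm_mulVec_le_sigmaMax_mul X (Pi.single ⟨0, hn⟩ 1)
  rw [colNorm_single, mul_one] at h1 h2
  exact h1.trans h2

lemma toLp_projOut {m n : ℕ} (u : Fin m → ℝ) (X : Matrix (Fin m) (Fin n) ℝ) (k : Fin n) :
    WithLp.toLp 2 (fun i => projOut u X i k) =
      (ℝ ∙ (WithLp.toLp 2 u : EuclideanSpace ℝ (Fin m)))ᗮ.starProjection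
        (WithLp.toLp 2 fun i => X i k) := by
  rw [Submodule.starProjection_orthogonal_val, Submodule.starProjection_singleton]
  have hu : ‖(WithLp.toLp 2 u : EuclideanSpace ℝ (Fin m))‖ ^ 2 = ∑ l, u l * u l := by
    simp [EuclideanSpace.norm_sq_eq, ← sq]
  ext i
  simp [projOut, hu, PiLp.inner_apply, mul_comm]

end Matrices

/-- Robustness of the successive projection algorithm, started from the residuals left by a
partial selection of columns approximating the vectors `w j`, `j ∈ S`. -/
lemma IsSPA.exists_near {m n : ℕ} {ι : Type*} [Fintype ι] [DecidableEq ι]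
    {w : ι → EuclideanSpace ℝ (Fin m)} {x : Fin n → EuclideanSpace ℝ (Fin m)}
    {h : Fin n → ι → ℝ} {σ τ ε δ : ℝ}
    (hσ : 0 < σ) (hε : 0 ≤ ε) (hδ0 : 0 ≤ δ) (hεσ : 32 * ε ≤ σ) (hστ : σ ≤ τ)
    (hw : ∀ c : ι → ℝ, σ * √(∑ j, c j ^ 2) ≤ ‖∑ j, c j • w j‖)
    (hwτ : ∀ j, ‖w j‖ ≤ τ)
    (hδ : 160 * ε * τ ^ 2 ≤ δ * σ ^ 2)
    (hδσ : δ * √(Fintype.card ι) ≤ σ / 2) (hδσ' : δ ≤ σ / 4)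
    (hnn : ∀ k j, 0 ≤ h k j) (hsum : ∀ k, ∑ j, h k j ≤ 1)
    (hx : ∀ k, ‖x k - ∑ j, h k j • w j‖ ≤ ε)
    (hpure : ∀ j, ∃ k, ‖x k - w j‖ ≤ ε)
    {Y : Matrix (Fin m) (Fin n) ℝ} {q : ℕ} {K : Finset (Fin n)} (hK : IsSPA Y q K)
    (S : Finset ι) (z : ι → EuclideanSpace ℝ (Fin m))
    (P : EuclideanSpace ℝ (Fin m) →ₗ[ℝ] EuclideanSpace ℝ (Fin m))
    (hY : ∀ k, WithLp.toLp 2 (fun i => Y i k) = P (x k))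
    (hz : ∀ j ∈ S, ‖w j - z j‖ ≤ δ) (hPz : ∀ j ∈ S, P (z j) = 0)
    (hP1 : ∀ v, ‖P v‖ ≤ ‖v‖)
    (hP : ∀ v, v - P v ∈ Submodule.span ℝ (z '' S))
    (hcard : Fintype.card ι ≤ S.card + q) :
    ∀ j ∉ S, ∃ k ∈ K, ‖w j - x k‖ ≤ δ := by
  induction hK generalizing S z P with
  | nil Y =>
    intro j hj
    have := Finset.card_lt_univ_of_notMem hj
    omega
  | step Y q k K hmax _ ih =>
    intro j hj
    have hk : ∀ l, ‖P (x l)‖ ≤ ‖P (x k)‖ := fun l => by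
      rw [← hY, ← hY, ← colNorm_eq_norm, ← colNorm_eq_norm]; exact hmax l
    obtain ⟨i, hi, hik⟩ := exists_near_of_norm_residual_max hσ hε hδ0 hεσ hστ hw hwτ hδ hδσ hδσ'
      hnn hsum hx hpure hz hPz hP1 hP ⟨j, Finset.mem_compl.2 hj⟩ hk
    by_cases hji : j = i
    · exact ⟨k, Finset.mem_insert_self _ _, hji ▸ hik⟩
    set z' := Function.update z i (x k) with hz'
    have hzS : ∀ l ∈ S, z' l = z l := fun l hl => by
      rw [hz', Function.update_of_ne]; rintro rfl; exact hi hl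
    have hzi : z' i = x k := Function.update_self _ _ _
    have hspan : Submodule.span ℝ (z '' S) ≤ Submodule.span ℝ (z' '' (insert i S : Finset ι)) := by
      refine Submodule.span_mono ?_
      rintro _ ⟨l, hl, rfl⟩
      exact ⟨l, Finset.mem_coe.2 (Finset.mem_insert_of_mem hl), hzS l hl⟩
    obtain ⟨k', hk', hle⟩ := ih (insert i S) z'
      ((ℝ ∙ P (x k))ᗮ.starProjection.toLinearMap ∘ₗ P)
      (fun l => by rw [toLp_projOut, hY, hY]; rfl)
      (fun l hl => by
        rcases Finset.mem_insert.1 hl with rfl | hl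
        · rwa [hzi]
        · rw [hzS l hl]; exact hz l hl)
      (fun l hl => by
        rcases Finset.mem_insert.1 hl with rfl | hl
        · rw [hzi]
          change (ℝ ∙ P (x k))ᗮ.starProjection (P (x k)) = 0
          rw [Submodule.starProjection_orthogonal_val, Submodule.starProjection_eq_self_iff.2
            (Submodule.mem_span_singleton_self _), sub_self]
        · rw [hzS l hl]; simp [hPz l hl])
      (fun v => (Submodule.norm_starProjection_apply_le _ _).trans (hP1 v))
      (fun v => by
        have hu : P (x k) ∈ Submodule.span ℝ (z' '' (insert i S : Finset ι)) := by
          have h1 : x k ∈ Submodule.span ℝ (z' '' (insert i S : Finset ι)) :=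
            Submodule.subset_span
              ⟨i, Finset.mem_coe.2 (Finset.mem_insert_self i S), hzi⟩
          simpa using Submodule.sub_mem _ h1 (hspan (hP (x k)))
        have h2 : v - (ℝ ∙ P (x k))ᗮ.starProjection (P v) =
            (v - P v) + (ℝ ∙ P (x k)).starProjection (P v) := by
          rw [Submodule.starProjection_orthogonal_val]; abel
        change v - (ℝ ∙ P (x k))ᗮ.starProjection (P v) ∈ _
        rw [h2]
        exact Submodule.add_mem _ (hspan (hP v))
          ((Submodule.span_singleton_le_iff_mem _ _).2 hu (Submodule.starProjection_apply_mem _ _)))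
      (by rw [Finset.card_insert_of_notMem hi]; omega)
      j (by simp [hji, hj])
    exact ⟨k', Finset.mem_insert_of_mem hk', hle⟩

/-- Corollary: robustness of SPA applied to a preconditioned near-separable matrix `Q * Mt`. -/
theorem preconditioned_spa_robustness :
    ∃ c₁ > (0 : ℝ), ∃ c₂ > (0 : ℝ),
      ∀ (n r : ℕ) (W : Matrix (Fin r) (Fin r) ℝ) (H : Matrix (Fin r) (Fin n) ℝ)
        (N Mt : Matrix (Fin r) (Fin n) ℝ) (ε : ℝ) (Q : Matrix (Fin r) (Fin r) ℝ)
        (K : Finset (Fin n)),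
        NearSeparable r n r W H N Mt ε →
        IsUnit (Q * W).det →
        ε ≤ c₁ * sigmaMin (Q * W) / (Real.sqrt r * sigmaMax Q * kappa (Q * W) ^ 2) →
        IsSPA (Q * Mt) r K →
        ∀ j : Fin r, ∃ k ∈ K,
          colNorm (fun i => W i j - Mt i k) ≤ c₂ * ε * kappa Q * kappa (Q * W) ^ 2 := by
  refine ⟨1 / 1000, by norm_num, 160, by norm_num, ?_⟩
  intro n r W H N Mt ε Q K ⟨hMt, _, hnn, hsum, hpure, hε, hN⟩ hdet hsmall hK j
  have hr : 0 < r := j.pos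
  have hQ : IsUnit Q.det := by
    rw [Matrix.det_mul] at hdet
    exact isUnit_of_mul_isUnit_left hdet
  set A := Q * W with hA
  set σ := sigmaMin A
  set τ := sigmaMax A
  have hσ : 0 < σ := sigmaMin_pos hr hdet
  have hστ : σ ≤ τ := sigmaMin_le_sigmaMax hr A
  have hQmin : 0 < sigmaMin Q := sigmaMin_pos hr hQ
  have hQmax : 0 < sigmaMax Q := hQmin.trans_le (sigmaMin_le_sigmaMax hr Q)
  have hκ : 1 ≤ kappa A := (one_le_div hσ).2 hστ
  have hκτ : kappa A * σ = τ := div_mul_cancel₀ _ hσ.ne'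
  have hr1 : 1 ≤ √(r : ℝ) := Real.one_le_sqrt.2 (by exact_mod_cast hr)
  set ε' := sigmaMax Q * ε with hε'
  have hε'0 : 0 ≤ ε' := mul_nonneg hQmax.le hε
  set B := ε' * kappa A ^ 2 with hB
  have hB0 : 0 ≤ B := mul_nonneg hε'0 (sq_nonneg _)
  have hBr : B * √(r : ℝ) ≤ 1 / 1000 * σ := by
    have hden : 0 < √(r : ℝ) * sigmaMax Q * kappa A ^ 2 := by positivity
    have h1 := (le_div_iff₀ hden).1 hsmall
    calc B * √(r : ℝ) = ε * (√(r : ℝ) * sigmaMax Q * kappa A ^ 2) := by rw [hB, hε']; ring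
      _ ≤ _ := h1
  have hBσ : B ≤ 1 / 1000 * σ := (le_mul_of_one_le_right hB0 hr1).trans hBr
  have hε'B : ε' ≤ B := le_mul_of_one_le_right hε'0 (one_le_pow₀ hκ)
  let w : Fin r → EuclideanSpace ℝ (Fin r) := fun l => WithLp.toLp 2 (fun i => A i l)
  let x : Fin n → EuclideanSpace ℝ (Fin r) := fun k => WithLp.toLp 2 (fun i => (Q * Mt) i k)
  have hcomb : ∀ c : Fin r → ℝ, ∑ l, c l • w l = WithLp.toLp 2 (A.mulVec c) := by
    intro c
    ext i
    simp [w, Matrix.mulVec, dotProduct, mul_comm]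
  have hnoise : ∀ k, ‖x k - ∑ l, H l k • w l‖ ≤ ε' := by
    intro k
    have h1 : x k - ∑ l, H l k • w l = WithLp.toLp 2 (Q.mulVec fun i => N i k) := by
      rw [hcomb fun l => H l k, sub_eq_iff_eq_add]
      ext i
      have h2 : Q * Mt = Q * N + A * H := by
        rw [hMt, Matrix.mul_add, hA, Matrix.mul_assoc, add_comm]
      change (Q * Mt) i k = (Q * N) i k + (A * H) i k
      rw [h2, Matrix.add_apply]
    rw [h1, ← colNorm_eq_norm]
    exact (colNorm_mulVec_le_sigmaMax_mul _ _).trans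
      (mul_le_mul_of_nonneg_left (hN k) hQmax.le)
  have hmain := hK.exists_near (w := w) (x := x) (h := fun k l => H l k) (σ := σ) (τ := τ)
    (ε := ε') (δ := 160 * B) hσ hε'0 (by positivity) (by linarith) hστ
    (fun c => by
      rw [hcomb, ← colNorm_eq_norm]
      exact sigmaMin_mul_le_colNorm_mulVec A c)
    (fun l => by
      have h1 := colNorm_mulVec_le_sigmaMax_mul A (Pi.single l 1)
      rw [colNorm_single, mul_one, Matrix.mulVec_single_one, colNorm_eq_norm] at h1
      exact h1)
    (by rw [hB, ← hκτ]; apply le_of_eq; ring)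
    (by rw [Fintype.card_fin]; linarith) (by linarith)
    (fun k l => hnn l k) hsum hnoise
    (fun l => by
      obtain ⟨k, hk⟩ := hpure l
      refine ⟨k, ?_⟩
      have h1 := hnoise k
      simpa [hk, ite_smul] using h1)
    ∅ 0 LinearMap.id (fun _ => rfl) (by simp) (by simp) (by simp) (by simp) (by simp)
  obtain ⟨k, hk, hle⟩ := hmain j (by simp)
  refine ⟨k, hk, ?_⟩
  have h1 : w j - x k = WithLp.toLp 2 (Q.mulVec fun i => W i j - Mt i k) := by
    ext i
    simp [w, x, hA, Matrix.mul_apply, Matrix.mulVec, dotProduct, mul_sub]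
  rw [h1, ← colNorm_eq_norm] at hle
  have h2 := (sigmaMin_mul_le_colNorm_mulVec Q _).trans hle
  rw [mul_comm, ← le_div_iff₀ hQmin] at h2
  refine h2.trans (le_of_eq ?_)
  rw [hB, hε', kappa, kappa]
  ring
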